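/- arXiv:1307.7456 — 2 statements merged into one kernel-verified Lean document; each statement's English description precedes it below -/
import Mathlib

section
/- Let {a_0,b_0}, {a_1,b_1}, {a_2,b_2} be three pairwise disjoint two-element subsets of the complex projective line ℙ¹(ℂ), each invariant under complex conjugation (so each pair consists either of two distinct real points or of a pair of complex conjugate non-real points). Then there exist homogeneous binary forms p_0, p_1, p_2 of degree 4 with real coefficients, having no common zero in ℙ¹(ℂ), such that the induced map θ : ℙ¹(ℂ) → ℙ²(ℂ), [s:t] ↦ [p_0(s,t):p_1(s,t):p_2(s,t)], satisfies θ(a_0)=θ(b_0)=[1:0:0], θ(a_1)=θ(b_1)=[0:1:0], θ(a_2)=θ(b_2)=[0:0:1], and moreover the θ-preimage of [1:0:0] is exactly {a_0,b_0}, the θ-preimage of [0:1:0] is exactly {a_1,b_1}, and the θ-preimage of [0:0:1] is exactly {a_2,b_2}. -/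
open MvPolynomial

/-- The point of `ℙ²(ℂ)` with homogeneous coordinates given by the `j`-th standard
basis vector: `[1:0:0]`, `[0:1:0]`, `[0:0:1]`. -/
noncomputable def stdPt (j : Fin 3) : Projectivization ℂ (Fin 3 → ℂ) :=
  Projectivization.mk ℂ (Pi.single j 1) (by
    intro h
    simpa using congrFun h j)

/-- The map `θ : ℙ¹(ℂ) → ℙ²(ℂ)` induced by a triple of binary forms,
`[s:t] ↦ [p₀(s,t) : p₁(s,t) : p₂(s,t)]` (with a junk value where all three forms
vanish, which does not occur when the forms have no common zero). -/
noncomputable def projMap (p : Fin 3 → MvPolynomial (Fin 2) ℂ)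
    (x : Projectivization ℂ (Fin 2 → ℂ)) : Projectivization ℂ (Fin 3 → ℂ) :=
  if h : (fun i => eval x.rep (p i)) = 0 then stdPt 0
  else Projectivization.mk ℂ (fun i => eval x.rep (p i)) h

/-- Complex conjugation acting on `ℙ¹(ℂ)`, `[α:β] ↦ [conj α : conj β]`. -/
noncomputable def projConj (x : Projectivization ℂ (Fin 2 → ℂ)) :
    Projectivization ℂ (Fin 2 → ℂ) :=
  Projectivization.mk ℂ (fun i => starRingEnd ℂ (x.rep i)) (by
    intro h
    apply x.rep_nonzero
    funext i
    simpa using congrFun h i)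

/-- Two nonzero vectors of the plane span the same line iff their determinant vanishes. -/
theorem mk_eq_mk_iff_det {K : Type*} [Field K] {v w : Fin 2 → K} (hv : v ≠ 0) (hw : w ≠ 0) :
    Projectivization.mk K v hv = Projectivization.mk K w hw ↔ w 1 * v 0 - w 0 * v 1 = 0 := by
  rw [Projectivization.mk_eq_mk_iff']
  constructor
  · rintro ⟨c, rfl⟩
    simp only [Pi.smul_apply, smul_eq_mul]
    ring
  · intro h
    by_cases h0 : w 0 = 0
    · have h1 : w 1 ≠ 0 := fun h1 => hw (by ext i; fin_cases i <;> simp [h0, h1])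
      have hv0 : v 0 = 0 := by simpa [h0, h1] using h
      refine ⟨v 1 / w 1, ?_⟩
      ext i
      fin_cases i
      · simp [h0, hv0]
      · simp [h1]
    · refine ⟨v 0 / w 0, ?_⟩
      ext i
      fin_cases i
      · simp [h0]
      · simp only [Fin.mk_one, Pi.smul_apply, smul_eq_mul]
        field_simp
        linear_combination h

/-- A complex vector proportional to its conjugate is proportional to a real vector. -/
theorem exists_smul_real_of_conj_eq_smul {ι : Type*} {w : ι → ℂ} (hw : w ≠ 0) (μ : ℂ)
    (h : ∀ i, starRingEnd ℂ (w i) = μ * w i) :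
    ∃ c : ℂ, c ≠ 0 ∧ ∃ r : ι → ℝ, ∀ i, (r i : ℂ) = c * w i := by
  obtain ⟨k, hk⟩ := Function.ne_iff.mp hw
  have hk : w k ≠ 0 := hk
  have hμ : μ ≠ 0 := by
    rintro rfl
    exact hk (by simpa using h k)
  refine ⟨(w k)⁻¹, inv_ne_zero hk, fun i => ((w k)⁻¹ * w i).re, fun i => ?_⟩
  refine Complex.conj_eq_iff_re.mp ?_
  rw [map_mul, map_inv₀, h, h]
  field_simp

theorem exists_conj_rep_of_projConj_eq {x y : Projectivization ℂ (Fin 2 → ℂ)}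
    (h : projConj x = y) :
    ∃ c : ℂ, ∀ i, starRingEnd ℂ (x.rep i) = c * y.rep i := by
  rw [← y.mk_rep, projConj, Projectivization.mk_eq_mk_iff'] at h
  obtain ⟨c, hc⟩ := h
  exact ⟨c, fun i => (congrFun hc i).symm⟩

/-- A conjugation-invariant pair of points of `ℙ¹(ℂ)` is the zero set of a real binary
quadratic form. -/
theorem exists_real_quadratic_form {a b : Projectivization ℂ (Fin 2 → ℂ)} (hab : a ≠ b)
    (hconj : projConj '' {a, b} = ({a, b} : Set (Projectivization ℂ (Fin 2 → ℂ)))) :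
    ∃ q : MvPolynomial (Fin 2) ℝ, q.IsHomogeneous 2 ∧
      ∀ (v : Fin 2 → ℂ) (hv : v ≠ 0), eval v (map Complex.ofRealHom q) = 0 ↔
        Projectivization.mk ℂ v hv = a ∨ Projectivization.mk ℂ v hv = b := by
  set α := a.rep with hα
  set β := b.rep with hβ
  let w : Fin 3 → ℂ := ![α 1 * β 1, -(α 0 * β 1 + α 1 * β 0), α 0 * β 0]
  have hw : w ≠ 0 := by
    intro h
    have e0 : α 1 * β 1 = 0 := congrFun h 0
    have e1 : -(α 0 * β 1 + α 1 * β 0) = 0 := congrFun h 1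
    have e2 : α 0 * β 0 = 0 := congrFun h 2
    have hα0 : ¬ (α 0 = 0 ∧ α 1 = 0) := fun h =>
      a.rep_nonzero (by ext i; fin_cases i; exacts [h.1, h.2])
    have hβ0 : ¬ (β 0 = 0 ∧ β 1 = 0) := fun h =>
      b.rep_nonzero (by ext i; fin_cases i; exacts [h.1, h.2])
    grind
  have hμ : ∃ μ : ℂ, ∀ i, starRingEnd ℂ (w i) = μ * w i := by
    have hswap : (projConj a = a ∧ projConj b = b) ∨ (projConj a = b ∧ projConj b = a) := by
      rw [Set.image_pair] at hconj
      have h1 : projConj a ∈ ({a, b} : Set _) := hconj ▸ Set.mem_insert _ _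
      have h2 : a ∈ ({projConj a, projConj b} : Set _) := hconj ▸ Set.mem_insert _ _
      have h3 : b ∈ ({projConj a, projConj b} : Set _) :=
        hconj ▸ Set.mem_insert_of_mem _ rfl
      simp only [Set.mem_insert_iff, Set.mem_singleton_iff] at h1 h2 h3
      grind
    obtain ⟨h1, h2⟩ | ⟨h1, h2⟩ := hswap <;>
    · obtain ⟨c, hc⟩ := exists_conj_rep_of_projConj_eq h1
      obtain ⟨d, hd⟩ := exists_conj_rep_of_projConj_eq h2
      simp only [← hα, ← hβ] at hc hd
      refine ⟨c * d, fun i => ?_⟩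
      fin_cases i <;> simp [w, hc, hd] <;> ring
  obtain ⟨μ, hμ⟩ := hμ
  obtain ⟨c, hc, r, hr⟩ := exists_smul_real_of_conj_eq_smul hw μ hμ
  refine ⟨C (r 0) * X 0 ^ 2 + C (r 1) * (X 0 * X 1) + C (r 2) * X 1 ^ 2, ?_, fun v hv => ?_⟩
  · exact (((isHomogeneous_X_pow 0 2).C_mul _).add
      (((isHomogeneous_X ℝ 0).mul (isHomogeneous_X ℝ 1)).C_mul _)).add
      ((isHomogeneous_X_pow 1 2).C_mul _)
  · have key : eval v (map Complex.ofRealHom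
        (C (r 0) * X 0 ^ 2 + C (r 1) * (X 0 * X 1) + C (r 2) * X 1 ^ 2)) =
        c * ((α 1 * v 0 - α 0 * v 1) * (β 1 * v 0 - β 0 * v 1)) := by
      simp [hr, w]
      ring
    rw [key, ← a.mk_rep, ← b.mk_rep, mk_eq_mk_iff_det, mk_eq_mk_iff_det]
    simp [hc, hα, hβ]

theorem projMap_eq_stdPt_iff {p : Fin 3 → MvPolynomial (Fin 2) ℂ}
    {x : Projectivization ℂ (Fin 2 → ℂ)} (h : ∃ i, eval x.rep (p i) ≠ 0) (j : Fin 3) :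
    projMap p x = stdPt j ↔ ∀ i, i ≠ j → eval x.rep (p i) = 0 := by
  have h' : (fun i => eval x.rep (p i)) ≠ 0 := Function.ne_iff.mpr h
  rw [projMap, dif_neg h', stdPt, Projectivization.mk_eq_mk_iff']
  constructor
  · rintro ⟨c, hc⟩ i hi
    simpa [hi] using (congrFun hc i).symm
  · intro hz
    refine ⟨eval x.rep (p j), ?_⟩
    ext i
    by_cases hi : i = j
    · subst hi
      simp
    · simp [hi, hz i hi]

/-- given three pairwise disjoint conjugation-invariant two-element
subsets `{a i, b i}` of `ℙ¹(ℂ)`, there are degree-4 binary forms `p₀, p₁, p₂` with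
real coefficients and no common zero such that the preimage of `[1:0:0]` under the
induced map is exactly `{a 0, b 0}`, that of `[0:1:0]` is `{a 1, b 1}` and that of
`[0:0:1]` is `{a 2, b 2}`. -/
theorem statement0 (a b : Fin 3 → Projectivization ℂ (Fin 2 → ℂ))
    (hab : ∀ i, a i ≠ b i)
    (hdisj : ∀ i j, i ≠ j → Disjoint ({a i, b i} : Set (Projectivization ℂ (Fin 2 → ℂ)))
      {a j, b j})
    (hconj : ∀ i, projConj '' {a i, b i} = ({a i, b i} : Set (Projectivization ℂ (Fin 2 → ℂ)))) :
    ∃ p : Fin 3 → MvPolynomial (Fin 2) ℂ,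
      (∀ i, (p i).IsHomogeneous 4) ∧
      (∀ i m, coeff m (p i) ∈ Set.range ((↑) : ℝ → ℂ)) ∧
      (∀ v : Fin 2 → ℂ, v ≠ 0 → ∃ i, eval v (p i) ≠ 0) ∧
      (∀ (j : Fin 3) (x : Projectivization ℂ (Fin 2 → ℂ)),
        projMap p x = stdPt j ↔ x = a j ∨ x = b j) := by
  choose q hq hqv using fun i => exists_real_quadratic_form (hab i) (hconj i)
  let p : Fin 3 → MvPolynomial (Fin 2) ℂ := fun j =>
    map Complex.ofRealHom (∏ i ∈ Finset.univ.erase j, q i)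
  have hpz : ∀ (v : Fin 2 → ℂ) (j : Fin 3), eval v (p j) = 0 ↔
      ∃ i, i ≠ j ∧ eval v (map Complex.ofRealHom (q i)) = 0 := by
    intro v j
    simp [p, map_prod, Finset.prod_eq_zero_iff]
  have huniq : ∀ v : Fin 2 → ℂ, v ≠ 0 → ∀ i j, eval v (map Complex.ofRealHom (q i)) = 0 →
      eval v (map Complex.ofRealHom (q j)) = 0 → i = j := by
    intro v hv i j hi hj
    by_contra hij
    rw [hqv i v hv] at hi
    rw [hqv j v hv] at hj
    exact Set.disjoint_left.mp (hdisj i j hij) hi hj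
  have hne : ∀ v : Fin 2 → ℂ, v ≠ 0 → ∃ i, eval v (p i) ≠ 0 := by
    intro v hv
    by_contra! h
    obtain ⟨i, -, hi⟩ := (hpz v 0).mp (h 0)
    obtain ⟨k, hki, hk⟩ := (hpz v i).mp (h i)
    exact hki (huniq v hv k i hk hi)
  refine ⟨p, fun j => ?_, fun j m => ?_, hne, fun j x => ?_⟩
  · have := IsHomogeneous.prod (Finset.univ.erase j) q (fun _ => 2) fun i _ => hq i
    simpa [p] using this.map Complex.ofRealHom
  · exact ⟨coeff m (∏ i ∈ Finset.univ.erase j, q i), by simp only [p, coeff_map]; rfl⟩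
  · have hx := x.rep_nonzero
    rw [projMap_eq_stdPt_iff (hne _ hx)]
    have hj := hqv j x.rep hx
    rw [x.mk_rep] at hj
    rw [← hj]
    constructor
    · intro h
      obtain ⟨i, hi⟩ := exists_ne j
      obtain ⟨k, -, hk⟩ := (hpz _ i).mp (h i hi)
      by_cases hkj : k = j
      · exact hkj ▸ hk
      · obtain ⟨l, hlk, hl⟩ := (hpz _ k).mp (h k hkj)
        exact absurd (huniq _ hx l k hl hk) hlk
    · intro h i hi
      exact (hpz _ i).mpr ⟨j, hi.symm, h⟩
end

section
/- For every natural number n ≥ 1, the ordered configuration space of n points on the circle, i.e., the subspace { f : Fin n → S¹ | f is injective } of the product space (S¹)ⁿ, where S¹ is the unit circle in ℂ, has exactly (n−1)! path components. -/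
namespace Circle

open Function Set
open scoped Real

variable {m : ℕ}

/-- The argument, in `(-π, π]`, of each later point of a configuration relative to the antipode of
its first point. -/
noncomputable def relArg (f : Fin (m + 1) → Circle) (i : Fin m) : ℝ :=
  Complex.arg (-((f i.succ / f 0 : Circle) : ℂ))

/-- The configuration with first point `c` and relative arguments `u`. -/
noncomputable def ofRelArg (c : Circle) (u : Fin m → ℝ) : Fin (m + 1) → Circle :=
  Fin.cons c fun i => Circle.exp (u i + π) * c

theorem neg_coe_mem_slitPlane {z : Circle} (hz : z ≠ 1) : -(z : ℂ) ∈ Complex.slitPlane := by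
  rw [Complex.mem_slitPlane_iff_arg]
  refine ⟨fun h => hz ?_, neg_ne_zero.mpr z.coe_ne_zero⟩
  have h1 := Complex.norm_mul_exp_arg_mul_I (-(z : ℂ))
  rw [h, norm_neg, Circle.norm_coe, Complex.exp_pi_mul_I] at h1
  ext
  simpa using h1.symm

theorem div_ne_one_of_injective {f : Fin (m + 1) → Circle} (hf : Injective f) (i : Fin m) :
    f i.succ / f 0 ≠ 1 :=
  div_ne_one.mpr fun h => Fin.succ_ne_zero i (hf h)

theorem relArg_mem_Ioo {f : Fin (m + 1) → Circle} (hf : Injective f) (i : Fin m) :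
    relArg f i ∈ Ioo (-π) π :=
  ⟨Complex.neg_pi_lt_arg _, (Complex.arg_le_pi _).lt_of_ne
    (Complex.mem_slitPlane_iff_arg.mp (neg_coe_mem_slitPlane (div_ne_one_of_injective hf i))).1⟩

theorem continuous_relArg (i : Fin m) :
    Continuous fun f : {f : Fin (m + 1) → Circle // Injective f} => relArg f.1 i := by
  refine continuous_iff_continuousAt.mpr fun f => ?_
  refine ContinuousAt.comp (g := Complex.arg)
    (f := fun f : {f : Fin (m + 1) → Circle // Injective f} => -((f.1 i.succ / f.1 0 : Circle) : ℂ))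
    (Complex.continuousAt_arg (neg_coe_mem_slitPlane (div_ne_one_of_injective f.2 i))) ?_
  have h (j : Fin (m + 1)) :
      Continuous fun f : {f : Fin (m + 1) → Circle // Injective f} => f.1 j :=
    (continuous_apply j).comp continuous_subtype_val
  exact (continuous_subtype_val.comp ((h _).div' (h _))).neg.continuousAt

theorem exp_relArg_add_pi (f : Fin (m + 1) → Circle) (i : Fin m) :
    Circle.exp (relArg f i + π) = f i.succ / f 0 := by
  have h := Complex.norm_mul_exp_arg_mul_I (-((f i.succ / f 0 : Circle) : ℂ))
  rw [norm_neg, Circle.norm_coe, Complex.ofReal_one, one_mul] at h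
  ext
  rw [Circle.coe_exp, Complex.ofReal_add, add_mul, Complex.exp_add, Complex.exp_pi_mul_I, relArg, h]
  ring

theorem ofRelArg_relArg (f : Fin (m + 1) → Circle) : ofRelArg (f 0) (relArg f) = f := by
  funext i
  refine Fin.cases rfl (fun i => ?_) i
  rw [ofRelArg, Fin.cons_succ, exp_relArg_add_pi, div_mul_cancel]

theorem relArg_ofRelArg (c : Circle) {u : Fin m → ℝ} (hu : ∀ i, u i ∈ Ioo (-π) π) :
    relArg (ofRelArg c u) = u := by
  funext i
  have h : -((Circle.exp (u i + π) : Circle) : ℂ) = Circle.exp (u i) := by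
    rw [Circle.coe_exp, Complex.ofReal_add, add_mul, Complex.exp_add, Complex.exp_pi_mul_I,
      Circle.coe_exp]
    ring
  simp only [relArg, ofRelArg, Fin.cons_succ, Fin.cons_zero, mul_div_cancel_right]
  rw [h]
  exact Circle.arg_exp (hu i).1 (hu i).2.le

theorem relArg_injective {f : Fin (m + 1) → Circle} (hf : Injective f) :
    Injective (relArg f) := fun i j h => by
  have h1 := exp_relArg_add_pi f i
  rw [h, exp_relArg_add_pi f j, div_left_inj] at h1
  exact Fin.succ_injective _ (hf h1.symm)

theorem ofRelArg_injective (c : Circle) {u : Fin m → ℝ} (hu : ∀ i, u i ∈ Ioo (-π) π)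
    (hinj : Injective u) : Injective (ofRelArg c u) := by
  refine Fin.cons_injective_iff.mpr ⟨?_, fun i j h => hinj ?_⟩
  · rintro ⟨i, hi⟩
    have h := mul_eq_right.mp hi
    have h' : Circle.exp (u i) = Circle.exp π := by
      rw [Circle.exp_add] at h
      rw [eq_inv_of_mul_eq_one_left h, ← Circle.exp_neg,
        show (-π : ℝ) = π - 2 * π by ring, Circle.exp_sub_two_pi]
    have := congrArg (fun z : Circle => Complex.arg z) h'
    simp only [Circle.arg_exp (hu i).1 (hu i).2.le,
      Circle.arg_exp (by linarith [Real.pi_pos] : -π < π) le_rfl] at this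
    exact (hu i).2.ne this
  · simp only [Circle.exp_add, mul_left_inj] at h
    rw [← Circle.arg_exp (hu i).1 (hu i).2.le, h, Circle.arg_exp (hu j).1 (hu j).2.le]

theorem continuous_ofRelArg :
    Continuous fun p : Circle × (Fin m → ℝ) => ofRelArg p.1 p.2 := by
  refine continuous_pi fun i => ?_
  refine Fin.cases ?_ (fun i => ?_) i
  · exact continuous_fst
  · simp only [ofRelArg, Fin.cons_succ]
    fun_prop

/-- The relative arguments listed in increasing order by `σ`. -/
def relArgChamber (σ : Equiv.Perm (Fin m)) : Set (Fin m → ℝ) :=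
  {u | (∀ i, u i ∈ Ioo (-π) π) ∧ StrictMono (u ∘ σ)}

theorem convex_relArgChamber (σ : Equiv.Perm (Fin m)) : Convex ℝ (relArgChamber σ) := by
  rintro u ⟨hu, hu'⟩ v ⟨hv, hv'⟩ a b ha hb hab
  refine ⟨fun i => convex_Ioo (-π) π (hu i) (hv i) ha hb hab, fun i j hij => ?_⟩
  have h1 : u (σ i) < u (σ j) := hu' hij
  have h2 : v (σ i) < v (σ j) := hv' hij
  simp only [comp_apply, Pi.add_apply, Pi.smul_apply, smul_eq_mul]
  rcases ha.eq_or_lt with rfl | ha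
  · obtain rfl : b = 1 := by linarith
    simpa using h2
  · nlinarith [mul_lt_mul_of_pos_left h1 ha, mul_le_mul_of_nonneg_left h2.le hb]

theorem relArgChamber_nonempty (σ : Equiv.Perm (Fin m)) : (relArgChamber σ).Nonempty := by
  refine ⟨fun i => (σ.symm i : ℝ) / (m + 1), fun i => ⟨?_, ?_⟩, fun i j hij => ?_⟩
  · exact (neg_lt_zero.mpr Real.pi_pos).trans_le (by positivity)
  · have : ((σ.symm i : ℕ) : ℝ) < m := by exact_mod_cast (σ.symm i).2
    refine lt_trans ((div_lt_one (by positivity)).mpr (by linarith)) ?_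
    linarith [Real.pi_gt_three]
  · simp only [comp_apply, Equiv.symm_apply_apply]
    gcongr
    exact hij

theorem injective_of_mem_relArgChamber {σ : Equiv.Perm (Fin m)} {u : Fin m → ℝ}
    (hu : u ∈ relArgChamber σ) : Injective u :=
  (Injective.of_comp_iff' u σ.bijective).mp hu.2.injective

theorem sort_eq_of_mem_relArgChamber {σ : Equiv.Perm (Fin m)} {u : Fin m → ℝ}
    (hu : u ∈ relArgChamber σ) : Tuple.sort u = σ :=
  (Tuple.eq_sort_iff.mpr ⟨hu.2.monotone,
    fun _ _ hij h => absurd h (hu.2 hij).ne⟩).symm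

theorem relArg_mem_relArgChamber {f : Fin (m + 1) → Circle} (hf : Injective f) :
    relArg f ∈ relArgChamber (Tuple.sort (relArg f)) :=
  ⟨relArg_mem_Ioo hf, (Tuple.monotone_sort _).strictMono_of_injective
    ((relArg_injective hf).comp (Equiv.injective _))⟩

theorem relArg_lt_of_joined {f g : {f : Fin (m + 1) → Circle // Injective f}} (h : Joined f g)
    {i j : Fin m} (hij : relArg f.1 i < relArg f.1 j) : relArg g.1 i < relArg g.1 j := by
  obtain ⟨γ⟩ := h
  by_contra! hji
  have hcont (k : Fin m) : Continuous fun t => relArg (γ t).1 k :=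
    (continuous_relArg k).comp γ.continuous
  obtain ⟨t, ht⟩ := mem_range_of_exists_le_of_exists_ge (c := (0 : ℝ))
    ((hcont j).sub (hcont i))
    ⟨1, by simpa using hji⟩ ⟨0, by simpa using hij.le⟩
  exact hij.ne (congrArg _ (relArg_injective (γ t).2 (sub_eq_zero.mp ht)).symm)

theorem sort_relArg_eq_of_joined {f g : {f : Fin (m + 1) → Circle // Injective f}}
    (h : Joined f g) : Tuple.sort (relArg f.1) = Tuple.sort (relArg g.1) :=
  (sort_eq_of_mem_relArgChamber ⟨relArg_mem_Ioo g.2, fun _ _ hij =>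
    relArg_lt_of_joined h ((relArg_mem_relArgChamber f.2).2 hij)⟩).symm

theorem joined_of_sort_relArg_eq {f g : {f : Fin (m + 1) → Circle // Injective f}}
    (h : Tuple.sort (relArg f.1) = Tuple.sort (relArg g.1)) : Joined f g := by
  set σ := Tuple.sort (relArg f.1) with hσ
  have hf : relArg f.1 ∈ relArgChamber σ := relArg_mem_relArgChamber f.2
  have hg : relArg g.1 ∈ relArgChamber σ := h ▸ relArg_mem_relArgChamber g.2
  have hc : Joined (f.1 0) (g.1 0) := ⟨Circle.path _ _⟩
  have hu := (((convex_relArgChamber σ).isPathConnected ⟨_, hf⟩).joinedIn _ hf _ hg).joined_subtype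
  let Ψ : Circle × relArgChamber σ → {f : Fin (m + 1) → Circle // Injective f} := fun p =>
    ⟨ofRelArg p.1 p.2.1, ofRelArg_injective _ p.2.2.1 (injective_of_mem_relArgChamber p.2.2)⟩
  have hΨ : Continuous Ψ := Continuous.subtype_mk
    (continuous_ofRelArg.comp (continuous_fst.prodMk (continuous_subtype_val.comp continuous_snd))) _
  convert (hc.prod hu).map hΨ using 1 <;> exact Subtype.ext (ofRelArg_relArg _).symm

/-- Path components of the configuration space of `m + 1` points on the circle correspond to the
orders in which the last `m` points are met when going around the circle from the first one. -/
noncomputable def zerothHomotopyConfigurationEquiv (m : ℕ) :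
    ZerothHomotopy {f : Fin (m + 1) → Circle // Injective f} ≃ Equiv.Perm (Fin m) :=
  Equiv.ofBijective
    (Quotient.lift (fun f => Tuple.sort (relArg f.1)) fun _ _ h => sort_relArg_eq_of_joined h) <| by
    refine ⟨?_, fun σ => ?_⟩
    · rintro ⟨f⟩ ⟨g⟩ h
      exact Quotient.sound (joined_of_sort_relArg_eq h)
    · obtain ⟨u, hu⟩ := relArgChamber_nonempty σ
      refine ⟨Quotient.mk _
        ⟨ofRelArg 1 u, ofRelArg_injective 1 hu.1 (injective_of_mem_relArgChamber hu)⟩, ?_⟩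
      simp only [Quotient.lift_mk, relArg_ofRelArg 1 hu.1, sort_eq_of_mem_relArgChamber hu]

end Circle

/-- for `n ≥ 1`, the ordered configuration space of `n` points on the
unit circle `S¹ ⊆ ℂ` (the subspace of injective tuples in `(S¹)ⁿ`) has exactly
`(n − 1)!` path components. -/
theorem statement11 (n : ℕ) (hn : 1 ≤ n) :
    Nat.card (ZerothHomotopy {f : Fin n → Circle // Function.Injective f}) =
      Nat.factorial (n - 1) := by
  obtain ⟨m, rfl⟩ := Nat.exists_eq_add_of_le' hn
  rw [Nat.card_congr (Circle.zerothHomotopyConfigurationEquiv m), Nat.card_eq_fintype_card,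
    Fintype.card_perm, Fintype.card_fin, Nat.add_sub_cancel]
end
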